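/- Let p be an odd prime, let q and k be coprime to p, and let k* be the inverse of k mod p. Then Σ_{n=0}^{p-1} ξ_p^(q k* n² + c n) = ε(p)·(qk*/p)·√p·λ^(k c²), where (·/p) is the Legendre symbol, ε(p) = 1 if p ≡ 1 (mod 4) and ε(p) = i if p ≡ 3 (mod 4), and λ = ξ_p^(−q*((p+1)/2)²) with q* the inverse of q mod p. -/

import Mathlib

open Complex Finset

/-- Generalized quadratic Gauss sum `G_p(a,b) = Σ_{n=0}^{p-1} e^{2πi(an²+bn)/p}`. -/
noncomputable def gaussSumG (p : ℕ) (a b : ℤ) : ℂ :=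
  ∑ n ∈ Finset.range p,
    Complex.exp (2 * Real.pi * Complex.I * ((a : ℂ) * (n : ℂ) ^ 2 + (b : ℂ) * n) / p)

section FresnelEvaluation

open Filter Topology MeasureTheory

/-- The Fresnel-type integral `∫₀^y e^{2πit²} dt`. -/
noncomputable def fresnel (y : ℝ) : ℂ := ∫ t in (0 : ℝ)..y, cexp (2 * Real.pi * I * (t : ℂ) ^ 2)

theorem continuous_cexp_mul_sq (c : ℂ) : Continuous fun t : ℝ => cexp (c * (t : ℂ) ^ 2) := by
  fun_prop

theorem hasDerivAt_cexp_mul_sq (c : ℂ) (t : ℝ) :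
    HasDerivAt (fun t : ℝ => cexp (c * (t : ℂ) ^ 2)) (2 * c * t * cexp (c * (t : ℂ) ^ 2)) t := by
  have h1 : HasDerivAt (fun z : ℂ => cexp (c * z ^ 2))
      (2 * c * t * cexp (c * (t : ℂ) ^ 2)) (t : ℂ) := by
    refine (((hasDerivAt_pow 2 (t : ℂ)).const_mul c).cexp).congr_deriv ?_
    push_cast
    ring
  exact h1.comp_ofReal

theorem norm_cexp_two_pi_mul_sq (t : ℝ) : ‖cexp (2 * Real.pi * I * (t : ℂ) ^ 2)‖ = 1 := by
  have : (2 * Real.pi * I * (t : ℂ) ^ 2) = ((2 * Real.pi * t ^ 2 : ℝ) : ℂ) * I := by push_cast; ring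
  rw [this, norm_exp_ofReal_mul_I]

theorem fresnel_sub (a b : ℝ) :
    fresnel b - fresnel a = ∫ t in a..b, cexp (2 * Real.pi * I * (t : ℂ) ^ 2) :=
  intervalIntegral.integral_interval_sub_left
    ((continuous_cexp_mul_sq _).intervalIntegrable _ _)
    ((continuous_cexp_mul_sq _).intervalIntegrable _ _)

theorem fresnel_neg (y : ℝ) : fresnel (-y) = -fresnel y := by
  have := intervalIntegral.integral_comp_neg (a := 0) (b := y)
    (fun t : ℝ => cexp (2 * Real.pi * I * (t : ℂ) ^ 2))
  unfold fresnel
  rw [intervalIntegral.integral_symm]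
  simpa using this.symm

/-- The Fresnel integral converges, by one integration by parts. -/
theorem exists_tendsto_fresnel : ∃ L, Tendsto fresnel atTop (𝓝 L) := by
  set c : ℂ := 2 * Real.pi * I with hc
  have hc0 : c ≠ 0 := two_pi_I_ne_zero
  set u : ℝ → ℂ := fun t => cexp (c * (t : ℂ) ^ 2) / (2 * c * t) with hu
  set w : ℝ → ℂ := fun t => cexp (c * (t : ℂ) ^ 2) / (2 * c * t ^ 2) with hw
  have hnorm : ∀ t : ℝ, ‖cexp (c * (t : ℂ) ^ 2)‖ = 1 := norm_cexp_two_pi_mul_sq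
  have hderiv : ∀ t : ℝ, t ≠ 0 → HasDerivAt u (cexp (c * (t : ℂ) ^ 2) - w t) t := by
    intro t ht
    have ht' : (t : ℂ) ≠ 0 := by exact_mod_cast ht
    have h2 : HasDerivAt (fun t : ℝ => 2 * c * (t : ℂ)) (2 * c) t := by
      simpa using ((hasDerivAt_id t).ofReal_comp).const_mul (2 * c)
    refine ((hasDerivAt_cexp_mul_sq c t).div h2 (by simp [hc0, ht'])).congr_deriv ?_
    simp only [hw]
    field_simp
  have hwi : IntegrableOn w (Set.Ioi 1) := by
    have h1 : IntegrableOn (fun t : ℝ => t ^ (-2 : ℝ)) (Set.Ioi 1) :=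
      integrableOn_Ioi_rpow_of_lt (by norm_num) one_pos
    refine Integrable.mono (h1.const_mul ‖2 * c‖⁻¹) ?_ ?_
    · refine Measurable.aestronglyMeasurable ?_
      fun_prop
    · refine (ae_restrict_iff' measurableSet_Ioi).2 (ae_of_all _ fun t ht => ?_)
      have ht0 : (0 : ℝ) < t := one_pos.trans ht
      rw [hw, norm_div, hnorm, norm_mul, norm_pow, norm_real, norm_mul ‖2 * c‖⁻¹, norm_inv,
        norm_norm, Real.rpow_neg ht0.le, norm_inv]
      simp [mul_comm]
  have hlim := intervalIntegral_tendsto_integral_Ioi 1 hwi tendsto_id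
  have hu0 : Tendsto u atTop (𝓝 0) := by
    rw [tendsto_zero_iff_norm_tendsto_zero]
    have : (fun t => ‖u t‖) = fun t : ℝ => ‖2 * c‖⁻¹ * |t|⁻¹ := by
      ext t
      rw [hu, norm_div, hnorm, norm_mul, norm_real, Real.norm_eq_abs, one_div, mul_inv]
    rw [this]
    simpa using (tendsto_inv_atTop_zero.comp tendsto_abs_atTop_atTop).const_mul ‖2 * c‖⁻¹
  refine ⟨_, Tendsto.congr' ?_ (((hu0.sub_const (u 1)).add hlim).const_add (fresnel 1))⟩
  filter_upwards [eventually_ge_atTop 1] with y hy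
  have hpos : ∀ t ∈ Set.uIcc 1 y, t ≠ 0 := fun t ht => by
    rw [Set.uIcc_of_le hy] at ht; linarith [ht.1]
  have hwc : IntervalIntegrable w volume 1 y :=
    (intervalIntegrable_iff_integrableOn_Ioc_of_le hy).2 (hwi.mono_set Set.Ioc_subset_Ioi_self)
  have hci := (continuous_cexp_mul_sq c).intervalIntegrable (μ := volume) 1 y
  have h := intervalIntegral.integral_eq_sub_of_hasDerivAt
    (fun t ht => hderiv t (hpos t ht)) (hci.sub hwc)
  rw [intervalIntegral.integral_sub hci hwc, ← fresnel_sub] at h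
  simp only [id]
  linear_combination -h

theorem HasSum.eq_of_tendsto_sub {B : ℤ → ℂ} {S S' : ℂ} (h : HasSum (fun l => B (l + 1) - B l) S)
    (h' : Tendsto (fun M : ℕ => B M - B (-M)) atTop (𝓝 S')) : S = S' := by
  refine tendsto_nhds_unique (h.nat_add_neg_add_one.tendsto_sum_nat) (h'.congr fun M => ?_)
  induction M with
  | zero => simp
  | succ M ih =>
    rw [Finset.sum_range_succ, ← ih]
    push_cast
    ring_nf

theorem integral_fourier_mul_cexp (N : ℕ) (hN : 0 < N) (m : ℤ) :
    ∫ x in (0 : ℝ)..N, cexp (-(2 * Real.pi * I * m * x)) * cexp (2 * Real.pi * I / N * (x : ℂ) ^ 2) =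
      cexp (-(Real.pi * I * m ^ 2 * N / 2)) * (Real.sqrt N *
        (fresnel ((1 - m / 2) * Real.sqrt N) - fresnel (-(m / 2) * Real.sqrt N))) := by
  have hs : Real.sqrt N ≠ 0 := by positivity
  have hsq : Real.sqrt N * Real.sqrt N = N := Real.mul_self_sqrt (by positivity)
  have hs' : (Real.sqrt N : ℂ) ≠ 0 := by exact_mod_cast hs
  have hsq' : (Real.sqrt N : ℂ) * Real.sqrt N = N := by exact_mod_cast hsq
  have h := intervalIntegral.integral_comp_div_sub (a := 0) (b := N)
    (fun t : ℝ => cexp (2 * Real.pi * I * (t : ℂ) ^ 2)) hs (m / 2 * Real.sqrt N)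
  have e1 : (N : ℝ) / Real.sqrt N - m / 2 * Real.sqrt N = (1 - m / 2) * Real.sqrt N := by
    field_simp; linear_combination (-2) * hsq
  have e2 : (0 : ℝ) / Real.sqrt N - m / 2 * Real.sqrt N = -(m / 2) * Real.sqrt N := by ring
  rw [e1, e2, ← fresnel_sub, real_smul] at h
  rw [← h, ← intervalIntegral.integral_const_mul]
  refine intervalIntegral.integral_congr fun x _ => ?_
  simp only [← Complex.exp_add]
  congr 1
  push_cast
  rw [← hsq']
  field_simp
  ring

theorem summable_fourierCoeffOn_of_hasDerivAt {a b : ℝ} (hab : a < b) {f f' f'' : ℝ → ℂ}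
    (hf : ∀ x, HasDerivAt f (f' x) x) (hf' : ∀ x, HasDerivAt f' (f'' x) x) (hf'' : Continuous f'')
    (hfab : f a = f b) : Summable (fourierCoeffOn hab f) := by
  have hf'c : Continuous f' := continuous_iff_continuousAt.2 fun x => (hf' x).continuousAt
  have hbound : ∃ C, ∀ n : ℤ, ‖fourierCoeffOn hab f'' n‖ ≤ C := by
    refine ⟨|1 / (b - a)| * ∫ x in a..b, ‖f'' x‖, fun n => ?_⟩
    rw [fourierCoeffOn_eq_integral, norm_smul, Real.norm_eq_abs]
    refine mul_le_mul_of_nonneg_left ?_ (abs_nonneg _)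
    refine (intervalIntegral.norm_integral_le_integral_norm hab.le).trans (le_of_eq ?_)
    refine intervalIntegral.integral_congr fun x _ => ?_
    have : ‖fourier (-n) (x : AddCircle (b - a))‖ = 1 := by
      rw [fourier_apply, Circle.norm_coe]
    simp only [norm_smul, this, one_mul]
  obtain ⟨C, hC⟩ := hbound
  have hs : Summable fun n : ℤ => ((b - a) * (‖f' b - f' a‖ + (b - a) * C) / (2 * Real.pi) ^ 2) *
      |1 / (n : ℝ) ^ 2| :=
    (summable_abs_iff.2 (Real.summable_one_div_int_pow.2 one_lt_two)).mul_left _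
  have hba : 0 < b - a := sub_pos.2 hab
  refine Summable.of_norm_bounded_eventually hs ?_
  filter_upwards [(Set.finite_singleton (0 : ℤ)).compl_mem_cofinite] with n hn
  have hn0 : n ≠ 0 := by simpa using hn
  have hnR : (n : ℝ) ≠ 0 := by exact_mod_cast hn0
  rw [fourierCoeffOn_of_hasDerivAt hab hn0 (fun x _ => hf x) (hf'c.intervalIntegrable _ _),
    fourierCoeffOn_of_hasDerivAt hab hn0 (fun x _ => hf' x) (hf''.intervalIntegrable _ _), hfab]
  have hnba : ‖((b : ℂ) - a)‖ = b - a := by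
    rw [← ofReal_sub, norm_real, Real.norm_of_nonneg hba.le]
  have key : ‖fourier (-n) (a : AddCircle (b - a)) * (f' b - f' a) -
      (b - a) * fourierCoeffOn hab f'' n‖ ≤ ‖f' b - f' a‖ + (b - a) * C := by
    refine (norm_sub_le _ _).trans ?_
    rw [norm_mul, norm_mul, hnba]
    have : ‖fourier (-n) (a : AddCircle (b - a))‖ = 1 := by
      rw [fourier_apply, Circle.norm_coe]
    rw [this, one_mul]
    gcongr
    exact hC n
  rw [sub_self, mul_zero, zero_sub, norm_mul, norm_neg, norm_mul, norm_mul, hnba]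
  have hc : ‖1 / (-2 * (Real.pi : ℂ) * I * n)‖ = 1 / (2 * Real.pi * |(n : ℝ)|) := by
    simp [abs_of_pos Real.pi_pos]
  rw [hc]
  calc _ ≤ 1 / (2 * Real.pi * |(n : ℝ)|) * ((b - a) * (1 / (2 * Real.pi * |(n : ℝ)|) *
        (‖f' b - f' a‖ + (b - a) * C))) := by gcongr
    _ = _ := by
      rw [abs_div, abs_one, abs_pow]
      have := abs_ne_zero.2 hnR
      field_simp

theorem hasSum_fourier_integral {f f' f'' : ℝ → ℂ}
    (hf : ∀ x, HasDerivAt f (f' x) x) (hf' : ∀ x, HasDerivAt f' (f'' x) x) (hf'' : Continuous f'')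
    (hf01 : f 0 = f 1) :
    HasSum (fun m : ℤ => ∫ x in (0 : ℝ)..1, cexp (-(2 * Real.pi * I * m * x)) * f x) (f 0) := by
  have hfc : Continuous f := continuous_iff_continuousAt.2 fun x => (hf x).continuousAt
  let F : C(AddCircle (1 : ℝ), ℂ) :=
    ⟨AddCircle.liftIco 1 0 f, AddCircle.liftIco_zero_continuous hf01 hfc.continuousOn⟩
  have hcoeff : ∀ m, fourierCoeff F m = fourierCoeffOn (lt_add_of_pos_right 0 one_pos) f m :=
    fun m => fourierCoeff_liftIco_eq f m
  have hsum : Summable (fourierCoeff F) := by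
    rw [funext hcoeff]
    exact summable_fourierCoeffOn_of_hasDerivAt _ hf hf' hf'' (by simpa using hf01)
  have h := has_pointwise_sum_fourier_series_of_summable hsum ((0 : ℝ) : AddCircle (1 : ℝ))
  have hF0 : F ((0 : ℝ) : AddCircle (1 : ℝ)) = f 0 :=
    AddCircle.liftIco_coe_apply (by simp)
  rw [hF0] at h
  refine h.congr_fun fun m => ?_
  rw [hcoeff, fourierCoeffOn_eq_integral]
  simp only [zero_add, sub_zero, div_one, one_smul, QuotientAddGroup.mk_zero,
    fourier_eval_zero, smul_eq_mul, mul_one]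
  refine intervalIntegral.integral_congr fun x _ => ?_
  simp only [fourier_coe_apply]
  push_cast
  ring_nf

theorem hasSum_gaussSumG (N : ℕ) (hN : 0 < N) :
    HasSum (fun m : ℤ => cexp (-(Real.pi * I * m ^ 2 * N / 2)) * (Real.sqrt N *
        (fresnel ((1 - m / 2) * Real.sqrt N) - fresnel (-(m / 2) * Real.sqrt N))))
      (gaussSumG N 1 0) := by
  have hN0 : (N : ℂ) ≠ 0 := by exact_mod_cast hN.ne'
  set c : ℂ := 2 * Real.pi * I / N with hc
  set g : ℝ → ℂ := fun t => cexp (c * (t : ℂ) ^ 2) with hg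
  have hgc : Continuous g := continuous_cexp_mul_sq c
  have hg' : ∀ t : ℝ, HasDerivAt g (2 * c * t * g t) t := hasDerivAt_cexp_mul_sq c
  have hg'' : ∀ t : ℝ, HasDerivAt (fun t : ℝ => 2 * c * t * g t)
      (2 * c * g t + 2 * c * t * (2 * c * t * g t)) t := fun t => by
    have h2 : HasDerivAt (fun t : ℝ => 2 * c * (t : ℂ)) (2 * c) t := by
      simpa using ((hasDerivAt_id t).ofReal_comp).const_mul (2 * c)
    exact h2.mul (hg' t)
  have hf := hasSum_fourier_integral (f := fun x => ∑ n ∈ Finset.range N, g (x + n))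
    (fun x => HasDerivAt.fun_sum fun n _ => (hg' (x + n)).comp_add_const x n)
    (fun x => HasDerivAt.fun_sum fun n _ => (hg'' (x + n)).comp_add_const x n)
    (by fun_prop) ?_
  · have h0 : ∑ n ∈ Finset.range N, g (0 + n) = gaussSumG N 1 0 := by
      unfold gaussSumG
      refine Finset.sum_congr rfl fun n _ => ?_
      simp only [hg, hc]
      push_cast
      ring_nf
    rw [h0] at hf
    refine hf.congr_fun fun m => ?_
    rw [← integral_fourier_mul_cexp N hN]
    have hcont : Continuous fun x : ℝ => cexp (-(2 * Real.pi * I * m * x)) * g x := by fun_prop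
    simp_rw [Finset.mul_sum]
    rw [intervalIntegral.integral_finsetSum fun n _ => by
      apply Continuous.intervalIntegrable; fun_prop]
    have hadj := intervalIntegral.sum_integral_adjacent_intervals (μ := volume)
      (a := fun n : ℕ => (n : ℝ)) (n := N)
      fun n _ => hcont.intervalIntegrable _ _
    rw [Nat.cast_zero] at hadj
    rw [← hadj]
    refine Finset.sum_congr rfl fun n _ => ?_
    have := intervalIntegral.integral_comp_add_right (a := 0) (b := 1)
      (fun x : ℝ => cexp (-(2 * Real.pi * I * m * x)) * g x) n
    rw [zero_add, add_comm (1 : ℝ)] at this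
    push_cast
    rw [← this]
    refine intervalIntegral.integral_congr fun x _ => ?_
    congr 1
    refine Complex.exp_eq_exp_iff_exists_int.2 ⟨-(m * n), ?_⟩
    push_cast
    ring
  · have hgN : g N = g 0 := by
      simp only [hg, hc]
      rw [show 2 * Real.pi * I / N * ((N : ℝ) : ℂ) ^ 2 = N * (2 * Real.pi * I) by
        push_cast; field_simp, Complex.exp_nat_mul_two_pi_mul_I]
      simp
    have h1 := Finset.sum_range_succ (fun n : ℕ => g n) N
    rw [Finset.sum_range_succ', hgN, Nat.cast_zero] at h1
    simpa [add_comm] using (add_right_cancel h1).symm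

theorem HasSum.int_even_add_odd {f : ℤ → ℂ} {a b : ℂ} (he : HasSum (fun l => f (2 * l)) a)
    (ho : HasSum (fun l => f (2 * l + 1)) b) : HasSum f (a + b) := by
  have he' := (mul_right_injective₀ (two_ne_zero' ℤ)).hasSum_range_iff.2 he
  have ho' := ((add_left_injective 1).comp
    (mul_right_injective₀ (two_ne_zero' ℤ))).hasSum_range_iff.2 ho
  refine he'.add_isCompl ?_ ho'
  simpa [Function.comp_def] using Int.isCompl_even_odd

/-- Poisson summation evaluates the quadratic Gauss sum up to a constant independent of `N`. -/
theorem exists_gaussSumG_eq :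
    ∃ L : ℂ, ∀ N : ℕ, 0 < N → gaussSumG N 1 0 = Real.sqrt N * (1 + (-I) ^ N) * L := by
  obtain ⟨L, hL⟩ := exists_tendsto_fresnel
  refine ⟨2 * L, fun N hN => ?_⟩
  have hs : 0 < Real.sqrt N := by positivity
  have hlim : ∀ r s : ℝ, Tendsto (fun M : ℕ => -fresnel ((r - M) * Real.sqrt N) +
      fresnel ((s + M) * Real.sqrt N)) atTop (𝓝 (2 * L)) := by
    intro r s
    have hcast : Tendsto (fun M : ℕ => (M : ℝ)) atTop atTop := tendsto_natCast_atTop_atTop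
    have h1 : Tendsto (fun M : ℕ => ((-r) + M) * Real.sqrt N) atTop atTop :=
      (tendsto_atTop_add_const_left _ _ hcast).atTop_mul_const hs
    have h2 : Tendsto (fun M : ℕ => (s + M) * Real.sqrt N) atTop atTop :=
      (tendsto_atTop_add_const_left _ _ hcast).atTop_mul_const hs
    rw [two_mul]
    refine ((hL.comp h1).add (hL.comp h2)).congr fun M => ?_
    simp only [Function.comp]
    rw [← fresnel_neg]
    ring_nf
  have htot := hasSum_gaussSumG N hN
  set d : ℤ → ℂ := fun m => cexp (-(Real.pi * I * m ^ 2 * N / 2)) * (Real.sqrt N *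
        (fresnel ((1 - m / 2) * Real.sqrt N) - fresnel (-(m / 2) * Real.sqrt N))) with hd
  have hev : Summable fun l : ℤ => d (2 * l) :=
    htot.summable.comp_injective (i := fun l : ℤ => 2 * l) (by intro a b h; simpa using h)
  have hodd : Summable fun l : ℤ => d (2 * l + 1) :=
    htot.summable.comp_injective (i := fun l : ℤ => 2 * l + 1) (by intro a b h; simpa using h)
  have hG : gaussSumG N 1 0 = (∑' l : ℤ, d (2 * l)) + ∑' l : ℤ, d (2 * l + 1) :=
    htot.unique (hev.hasSum.int_even_add_odd hodd.hasSum)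
  have hE : (∑' l : ℤ, d (2 * l)) = Real.sqrt N * (2 * L) := by
    refine HasSum.eq_of_tendsto_sub
      (B := fun l : ℤ => Real.sqrt N * -fresnel ((1 - l) * Real.sqrt N))
      (hev.hasSum.congr_fun fun l => ?_) (((hlim 1 1).const_mul _).congr fun M => ?_)
    · simp only [hd]
      have : cexp (-(Real.pi * I * ((2 * l : ℤ) : ℂ) ^ 2 * N / 2)) = 1 :=
        Complex.exp_eq_one_iff.2 ⟨-(l ^ 2 * N), by push_cast; ring⟩
      rw [this]
      push_cast
      ring_nf
    · push_cast
      ring_nf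
  have hO : (∑' l : ℤ, d (2 * l + 1)) = Real.sqrt N * (-I) ^ N * (2 * L) := by
    refine HasSum.eq_of_tendsto_sub
      (B := fun l : ℤ => Real.sqrt N * (-I) ^ N * -fresnel ((1 / 2 - l) * Real.sqrt N))
      (hodd.hasSum.congr_fun fun l => ?_) (((hlim (1 / 2) (1 / 2)).const_mul _).congr fun M => ?_)
    · simp only [hd]
      have : cexp (-(Real.pi * I * ((2 * l + 1 : ℤ) : ℂ) ^ 2 * N / 2)) = (-I) ^ N := by
        rw [← Complex.exp_neg_pi_div_two_mul_I, ← Complex.exp_nat_mul]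
        refine Complex.exp_eq_exp_iff_exists_int.2 ⟨-((l ^ 2 + l) * N), ?_⟩
        push_cast
        ring
      rw [this]
      push_cast
      ring_nf
    · push_cast
      ring_nf
  rw [hG, hE, hO]
  ring

theorem gaussSumG_one_zero (N : ℕ) (hN : 0 < N) :
    gaussSumG N 1 0 = Real.sqrt N * ((1 + (-I) ^ N) / (1 - I)) := by
  obtain ⟨L, hL⟩ := exists_gaussSumG_eq
  have h1 : (1 - I) * L = 1 := by
    have := hL 1 one_pos
    simpa [gaussSumG, sub_eq_add_neg] using this.symm
  rw [hL N hN, div_eq_mul_inv, ← eq_inv_of_mul_eq_one_right h1, mul_assoc]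

end FresnelEvaluation

theorem gaussSumG_eq_sum_zmod (p : ℕ) [NeZero p] (a b : ℤ) :
    gaussSumG p a b = ∑ x : ZMod p, (ZMod.stdAddChar ((a : ZMod p) * x ^ 2 + (b : ZMod p) * x) : ℂ) := by
  unfold gaussSumG
  refine Finset.sum_bij' (fun n _ => (n : ZMod p)) (fun x _ => x.val) ?_ ?_ ?_ ?_ ?_
  · simp
  · intro x _; simpa using ZMod.val_lt x
  · intro n hn; simpa using ZMod.val_cast_of_lt (by simpa using hn)
  · simp
  · intro n _
    have : ((a : ZMod p) * (n : ZMod p) ^ 2 + b * (n : ZMod p)) =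
      ((a * n ^ 2 + b * n : ℤ) : ZMod p) := by push_cast; ring
    rw [this, ZMod.stdAddChar_coe]
    push_cast
    ring_nf

theorem sum_sq_eq_sum_quadraticChar (p : ℕ) [Fact p.Prime] (hp : p ≠ 2) (F : ZMod p → ℂ) :
    ∑ x, F (x ^ 2) = ∑ x, ((quadraticChar (ZMod p) x : ℂ) + 1) * F x := by
  have hF : ringChar (ZMod p) ≠ 2 := by rwa [ZMod.ringChar_zmod_n]
  rw [← Finset.sum_fiberwise (s := Finset.univ) (g := fun x : ZMod p => x ^ 2)]
  refine Finset.sum_congr rfl fun y _ => ?_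
  rw [Finset.sum_congr rfl (g := fun _ => F y) (by intro x hx; rw [(Finset.mem_filter.1 hx).2])]
  have := quadraticChar_card_sqrts hF y
  rw [Finset.sum_const, nsmul_eq_mul]
  congr 1
  have h2 : (({x : ZMod p | x ^ 2 = y}.toFinset).card : ℂ) = quadraticChar (ZMod p) y + 1 := by
    exact_mod_cast this
  rw [← h2]
  congr 2
  ext; simp

theorem sum_stdAddChar_mul_sq (p : ℕ) [Fact p.Prime] (hp : p ≠ 2) (a : ZMod p) (ha : a ≠ 0) :
    ∑ x : ZMod p, ZMod.stdAddChar (a * x ^ 2) =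
      (quadraticChar (ZMod p) a : ℂ) * ∑ x : ZMod p, (ZMod.stdAddChar (x ^ 2) : ℂ) := by
  have hF : ringChar (ZMod p) ≠ 2 := by rwa [ZMod.ringChar_zmod_n]
  have key : ∀ b : ZMod p, b ≠ 0 → ∑ x : ZMod p, (ZMod.stdAddChar (b * x ^ 2) : ℂ) =
      ∑ x : ZMod p, (quadraticChar (ZMod p) x : ℂ) * ZMod.stdAddChar (b * x) := by
    intro b hb
    rw [sum_sq_eq_sum_quadraticChar p hp (fun y => (ZMod.stdAddChar (b * y) : ℂ))]
    simp_rw [add_mul, one_mul, Finset.sum_add_distrib]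
    have h := AddChar.sum_mulShift (R := ZMod p) (R' := ℂ) b (ZMod.isPrimitive_stdAddChar p)
    simp_rw [hb, mul_comm _ b] at h
    simp [h]
  have h1 := key 1 one_ne_zero
  simp only [one_mul] at h1
  rw [key a ha, h1, Finset.mul_sum]
  rw [← Equiv.sum_comp (Equiv.mulLeft₀ a ha) (fun x =>
     (quadraticChar (ZMod p) a : ℂ) * ((quadraticChar (ZMod p) x : ℂ) * ZMod.stdAddChar x))]
  refine Finset.sum_congr rfl fun x _ => ?_
  have h2 : (quadraticChar (ZMod p) a : ℂ) * quadraticChar (ZMod p) a = 1 := by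
    exact_mod_cast (by rw [← sq]; exact quadraticChar_sq_one ha)
  simp only [Equiv.mulLeft₀_apply, map_mul, Int.cast_mul]
  rw [← mul_assoc, ← mul_assoc, h2, one_mul]

theorem gaussSum_eval (p : ℕ) [Fact p.Prime] (hpo : Odd p)
    (q k qs ks : ℤ) (hq : q * qs ≡ 1 [ZMOD (p : ℤ)]) (hk : k * ks ≡ 1 [ZMOD (p : ℤ)])
    (c : ℤ) :
    gaussSumG p (q * ks) c =
      (if p % 4 = 1 then (1 : ℂ) else Complex.I) *
        ((legendreSym p (q * ks) : ℤ) : ℂ) * (Real.sqrt p : ℂ) *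
        (Complex.exp (-(2 * Real.pi * Complex.I) * (qs : ℂ) *
          (((p + 1) / 2 : ℕ) : ℂ) ^ 2 / p)) ^ (k * c ^ 2) := by
  have hp2 : p ≠ 2 := by rintro rfl; exact absurd hpo (by decide)
  have hq' : (q : ZMod p) * qs = 1 := by
    have := (ZMod.intCast_eq_intCast_iff _ _ _).2 hq; simpa using this
  have hk' : (k : ZMod p) * ks = 1 := by
    have := (ZMod.intCast_eq_intCast_iff _ _ _).2 hk; simpa using this
  set h : ℕ := (p + 1) / 2 with hh
  have hh2 : (2 : ZMod p) * h = 1 := by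
    have h1 : 2 * h = p + 1 := by obtain ⟨m, hm⟩ := hpo; omega
    have h2 : ((2 * h : ℕ) : ZMod p) = ((p + 1 : ℕ) : ZMod p) := by rw [h1]
    simpa using h2
  have ha : ((q * ks : ℤ) : ZMod p) ≠ 0 := by
    push_cast
    exact mul_ne_zero (left_ne_zero_of_mul_eq_one hq') (right_ne_zero_of_mul_eq_one hk')
  have hexp : Complex.exp (-(2 * Real.pi * Complex.I) * (qs : ℂ) * (h : ℂ) ^ 2 / p) ^
      (k * c ^ 2) = ZMod.stdAddChar (((-(qs * h ^ 2 * (k * c ^ 2)) : ℤ)) : ZMod p) := by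
    rw [ZMod.stdAddChar_coe, ← Complex.exp_int_mul]
    congr 1
    push_cast
    ring
  have hsum : gaussSumG p (q * ks) c =
      ZMod.stdAddChar (((-(qs * h ^ 2 * (k * c ^ 2)) : ℤ)) : ZMod p) *
      ∑ x : ZMod p, (ZMod.stdAddChar (((q * ks : ℤ) : ZMod p) * x ^ 2) : ℂ) := by
    rw [gaussSumG_eq_sum_zmod, Finset.mul_sum,
      ← Equiv.sum_comp (Equiv.addRight ((c * k * qs * h : ZMod p)))
        (fun x => (ZMod.stdAddChar (((-(qs * h ^ 2 * (k * c ^ 2)) : ℤ)) : ZMod p) : ℂ) *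
          ZMod.stdAddChar (((q * ks : ℤ) : ZMod p) * x ^ 2))]
    refine Finset.sum_congr rfl fun x _ => ?_
    rw [← AddChar.map_add_eq_mul]
    congr 1
    simp only [Equiv.coe_addRight]
    push_cast
    generalize (q : ZMod p) = Q at *
    generalize (k : ZMod p) = K at *
    generalize (qs : ZMod p) = Q' at *
    generalize (ks : ZMod p) = K' at *
    generalize (c : ZMod p) = C at *
    generalize (h : ZMod p) = H at *
    have e : Q * K' * (x + C * K * Q' * H) ^ 2 = Q * K' * x ^ 2 +
        (Q * Q') * (K * K') * (2 * H) * C * x +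
      (Q * Q') * (K * K') * (Q' * H ^ 2 * (K * C ^ 2)) := by ring
    rw [e, hq', hk', hh2]
    ring
  have hone : ∑ x : ZMod p, (ZMod.stdAddChar (x ^ 2) : ℂ) = gaussSumG p 1 0 := by
    rw [gaussSumG_eq_sum_zmod]; simp
  rw [hexp, hsum, sum_stdAddChar_mul_sq p hp2 _ ha, hone,
    gaussSumG_one_zero p (Fact.out : p.Prime).pos]
  have hε : (1 + (-I) ^ p) / (1 - I) = if p % 4 = 1 then (1 : ℂ) else Complex.I := by
    have h1I : (1 : ℂ) - I ≠ 0 := by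
      intro h; simpa using congrArg Complex.re h
    have hpow : (-I) ^ 4 = 1 := by rw [Even.neg_pow (by decide), I_pow_four]
    rw [← Nat.div_add_mod p 4, pow_add, pow_mul, hpow, one_pow, one_mul]
    have : p % 4 = 1 ∨ p % 4 = 3 := by obtain ⟨m, hm⟩ := hpo; omega
    rw [div_eq_iff h1I]
    rcases this with h | h <;> simp [h, pow_succ] <;> ring_nf <;> simp <;> ring
  rw [hε]
  unfold legendreSym
  ring
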